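/- arXiv:2506.11746 — 4 statements merged into one kernel-verified Lean document; each statement's English description precedes it below -/
import Mathlib

section
/- Let X and Y be complex Banach spaces, let n ≥ 1, and let V ⊆ ℂⁿ be open and connected. Let A : V → L(X, Y) be an analytic map into the space of continuous linear operators from X to Y, and assume that for every z ∈ V there exists a continuous linear isomorphism B_z : Y → X (with continuous inverse) such that B_z ∘ A(z) − id_X is a compact operator on X. Then the set {z ∈ V : A(z) is a continuous linear isomorphism from X onto Y} is either empty or open and dense in V. -/
open Set Filter Topology ContinuousLinearMap

section FredholmAlternative

variable {𝕜 X : Type*} [RCLike 𝕜] [NormedAddCommGroup X] [NormedSpace 𝕜 X]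

/-- The kernel of a compact perturbation of the identity is finite-dimensional. -/
theorem finiteDimensional_ker_of_isCompactOperator_sub_one {S : X →L[𝕜] X}
    (hS : IsCompactOperator (S - 1 : X →L[𝕜] X)) :
    FiniteDimensional 𝕜 (LinearMap.ker (S : X →ₗ[𝕜] X)) := by
  set N := LinearMap.ker (S : X →ₗ[𝕜] X)
  have hcl : IsClosed (N : Set X) := S.isClosed_ker
  have hval : IsCompactOperator (fun x : N ↦ (x : X)) := by
    have h : (fun x : N ↦ (x : X)) = -((S - 1 : X →L[𝕜] X) ∘ N.subtypeL) := by
      funext x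
      have hx : S (x : X) = 0 := x.2
      simp [hx]
    rw [h]
    exact (hS.comp_clm N.subtypeL).neg
  exact .of_isCompactOperator_id (𝕜 := 𝕜) (hval.codRestrict (fun x ↦ x.2) hcl)

variable [CompleteSpace X]

/-- Fredholm alternative: an injective compact perturbation of the identity is invertible. -/
theorem isUnit_of_isCompactOperator_sub_one {S : X →L[𝕜] X}
    (hS : IsCompactOperator (S - 1 : X →L[𝕜] X)) (hinj : Function.Injective S) : IsUnit S := by
  have hneg : IsCompactOperator (1 - S : X →L[𝕜] X) := by
    rw [← neg_sub]
    exact hS.neg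
  rcases hneg.hasEigenvalue_or_mem_resolventSet (one_ne_zero (α := 𝕜)) with h | h
  · obtain ⟨v, hv⟩ := h.exists_hasEigenvector
    have hSv : S v = S 0 := by simpa using hv.apply_eq_smul
    exact absurd (hinj hSv) hv.2
  · simpa [spectrum.mem_resolventSet_iff] using h

/-- A surjective compact perturbation of the identity is invertible. -/
theorem isUnit_of_isCompactOperator_sub_one_of_surjective {S : X →L[𝕜] X}
    (hS : IsCompactOperator (S - 1 : X →L[𝕜] X)) (hsurj : Function.Surjective S) :
    IsUnit S := by
  have := finiteDimensional_ker_of_isCompactOperator_sub_one hS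
  obtain ⟨P, hP⟩ := Submodule.ClosedComplemented.of_finiteDimensional
    (LinearMap.ker (S : X →ₗ[𝕜] X))
  let e := S.equivProdOfSurjectiveOfIsCompl P (LinearMap.range_eq_top.2 hsurj)
    (LinearMap.range_eq_top.2 fun x ↦ ⟨x, hP x⟩) (LinearMap.isCompl_of_proj hP)
  let R : X →L[𝕜] X := e.symm.toContinuousLinearMap.comp (.inl 𝕜 X _)
  have hSR : S * R = 1 := by
    ext y
    exact congrArg Prod.fst (e.apply_symm_apply (y, 0))
  have hRinj : Function.Injective R :=
    Function.LeftInverse.injective (g := S) fun x ↦ DFunLike.congr_fun hSR x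
  have hR : IsCompactOperator (R - 1 : X →L[𝕜] X) := by
    have h : R - 1 = -((S - 1) * R) := by rw [sub_mul, hSR, one_mul, neg_sub]
    rw [h]
    exact (hS.comp_clm R).neg
  obtain ⟨u, hu⟩ := isUnit_of_isCompactOperator_sub_one hR hRinj
  rw [← hu] at hSR
  rw [Units.eq_inv_of_mul_eq_one_right hSR]
  exact u⁻¹.isUnit

/-- A compact perturbation of the identity becomes invertible after adding an operator that
factors through a finite-dimensional space. -/
theorem exists_isUnit_add_comp_of_isCompactOperator_sub_one {T : X →L[𝕜] X}
    (hT : IsCompactOperator (T - 1 : X →L[𝕜] X)) :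
    ∃ (N : Submodule 𝕜 X) (_ : FiniteDimensional 𝕜 N) (J : N →L[𝕜] X) (P : X →L[𝕜] N),
      IsUnit (T + J.comp P) := by
  have hfin := finiteDimensional_ker_of_isCompactOperator_sub_one hT
  set N := LinearMap.ker (T : X →ₗ[𝕜] X)
  obtain ⟨P, hP⟩ := Submodule.ClosedComplemented.of_finiteDimensional N
  let q := (LinearMap.range (T : X →ₗ[𝕜] X)).mkQ
  have hcompact (J : N →L[𝕜] X) : IsCompactOperator (T + J.comp P - 1 : X →L[𝕜] X) := by
    rw [add_sub_right_comm]
    have := FiniteDimensional.proper_rclike 𝕜 N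
    exact hT.add ((isCompactOperator_of_locallyCompactSpace_dom P).clm_comp J)
  have hlift (j : N →ₗ[𝕜] X ⧸ LinearMap.range (T : X →ₗ[𝕜] X)) :
      ∃ J : N →L[𝕜] X, ∀ x, q (J x) = j x := by
    obtain ⟨J, hJ⟩ := Module.projective_lifting_property q j (Submodule.mkQ_surjective _)
    exact ⟨LinearMap.toContinuousLinearMap J, fun x ↦ LinearMap.congr_fun hJ x⟩
  have hqT (x : X) : q (T x) = 0 := (Submodule.Quotient.mk_eq_zero _).2 ⟨x, rfl⟩
  refine ⟨N, hfin, ?_⟩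
  rcases le_total (Module.rank 𝕜 N) (Module.rank 𝕜 (X ⧸ LinearMap.range (T : X →ₗ[𝕜] X)))
    with h | h
  · obtain ⟨j, hj⟩ := rank_le_iff_exists_linearMap.1 h
    obtain ⟨J, hJ⟩ := hlift j
    refine ⟨J, P, isUnit_of_isCompactOperator_sub_one (hcompact J) ?_⟩
    refine (injective_iff_map_eq_zero _).2 fun x hx ↦ ?_
    have hx' : T x + J (P x) = 0 := hx
    have hPx : P x = 0 := hj <| by
      simpa [hqT, hJ] using congrArg q hx'
    have hTx : x ∈ N := show T x = 0 by simpa [hPx] using hx'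
    simpa [hPx] using (congrArg Subtype.val (hP ⟨x, hTx⟩)).symm
  · obtain ⟨g, hg⟩ := rank_le_iff_exists_linearMap.1 h
    obtain ⟨j, hj⟩ := g.exists_leftInverse_of_injective (LinearMap.ker_eq_bot.2 hg)
    obtain ⟨J, hJ⟩ := hlift j
    refine ⟨J, P, isUnit_of_isCompactOperator_sub_one_of_surjective (hcompact J) fun y ↦ ?_⟩
    set m := g (q y)
    have hm : y - J m ∈ LinearMap.range (T : X →ₗ[𝕜] X) := by
      rw [← Submodule.Quotient.mk_eq_zero]
      change q (y - J m) = 0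
      rw [map_sub, hJ, sub_eq_zero]
      exact (LinearMap.congr_fun hj (q y)).symm
    obtain ⟨x, hx⟩ := hm
    have hker (v : N) : T (v : X) = 0 := v.2
    refine ⟨x - P x + m, ?_⟩
    have hx' : T x = y - J m := hx
    simp [hker, hP, hx']

end FredholmAlternative

section AnalyticFamily

theorem ContinuousLinearMap.isUnit_one_sub_comp_of_isUnit {𝕜 E F : Type*}
    [NontriviallyNormedField 𝕜] [NormedAddCommGroup E] [NormedSpace 𝕜 E]
    [NormedAddCommGroup F] [NormedSpace 𝕜 F] {a : E →L[𝕜] F} {b : F →L[𝕜] E}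
    (h : IsUnit (1 - b.comp a)) : IsUnit (1 - a.comp b) := by
  obtain ⟨c, hc₁, hc₂⟩ := isUnit_iff_exists.1 h
  refine isUnit_iff_exists.2 ⟨1 + a.comp (c.comp b), ?_, ?_⟩
  · ext x
    have := congrArg a (DFunLike.congr_fun hc₁ (b x))
    simp only [mul_apply_eq_comp, sub_apply, one_apply_eq_self, comp_apply, add_apply,
      map_sub, map_add] at this ⊢
    linear_combination (norm := module) this
  · ext x
    have := congrArg a (DFunLike.congr_fun hc₂ (b x))
    simp only [mul_apply_eq_comp, sub_apply, one_apply_eq_self, comp_apply, add_apply,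
      map_sub] at this ⊢
    linear_combination (norm := module) this

/-- `1 - a ∘ b` is invertible if and only if `1 - b ∘ a` is, for operators between possibly
different spaces. -/
theorem ContinuousLinearMap.isUnit_one_sub_comp_comm {𝕜 E F : Type*}
    [NontriviallyNormedField 𝕜] [NormedAddCommGroup E] [NormedSpace 𝕜 E]
    [NormedAddCommGroup F] [NormedSpace 𝕜 F] (a : E →L[𝕜] F) (b : F →L[𝕜] E) :
    IsUnit (1 - a.comp b) ↔ IsUnit (1 - b.comp a) :=
  ⟨isUnit_one_sub_comp_of_isUnit, isUnit_one_sub_comp_of_isUnit⟩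

/-- The determinant of an analytic family of matrices is analytic. -/
theorem AnalyticAt.matrix_det {𝕜 E ι : Type*} [NontriviallyNormedField 𝕜]
    [NormedAddCommGroup E] [NormedSpace 𝕜 E] [Fintype ι] [DecidableEq ι]
    {M : E → Matrix ι ι 𝕜} {z₀ : E} (hM : ∀ i j, AnalyticAt 𝕜 (fun z ↦ M z i j) z₀) :
    AnalyticAt 𝕜 (fun z ↦ (M z).det) z₀ := by
  simp only [Matrix.det_apply']
  refine Finset.analyticAt_fun_sum _ fun σ _ ↦ analyticAt_const.mul ?_
  exact Finset.analyticAt_fun_prod _ fun i _ ↦ hM _ _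

theorem ContinuousLinearMap.isUnit_iff_isInvertible {𝕜 E : Type*}
    [NontriviallyNormedField 𝕜] [NormedAddCommGroup E] [NormedSpace 𝕜 E] {f : E →L[𝕜] E} :
    IsUnit f ↔ f.IsInvertible :=
  ⟨fun ⟨u, hu⟩ ↦ ⟨ContinuousLinearEquiv.unitsEquiv 𝕜 E u, hu⟩,
    fun ⟨e, he⟩ ↦ ⟨(ContinuousLinearEquiv.unitsEquiv 𝕜 E).symm e, he⟩⟩

theorem ContinuousLinearMap.isUnit_iff_det_ne_zero {𝕜 N : Type*} [RCLike 𝕜]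
    [NormedAddCommGroup N] [NormedSpace 𝕜 N] [FiniteDimensional 𝕜 N] (D : N →L[𝕜] N) :
    IsUnit D ↔ LinearMap.det (D : N →ₗ[𝕜] N) ≠ 0 := by
  have := FiniteDimensional.complete 𝕜 N
  rw [isUnit_iff_bijective, ← isUnit_iff_ne_zero, ← LinearMap.isUnit_iff_isUnit_det,
    Module.End.isUnit_iff]
  rfl

/-- Near a point where an analytic family of operators is a compact perturbation of the identity,
invertibility is governed by the non-vanishing of a scalar analytic function. -/
theorem AnalyticAt.exists_analyticAt_isUnit_iff_ne_zero {𝕜 E X : Type*} [RCLike 𝕜]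
    [NormedAddCommGroup E] [NormedSpace 𝕜 E]
    [NormedAddCommGroup X] [NormedSpace 𝕜 X] [CompleteSpace X]
    {f : E → X →L[𝕜] X} {z₀ : E} (hf : AnalyticAt 𝕜 f z₀)
    (hcompact : IsCompactOperator (f z₀ - 1 : X →L[𝕜] X)) :
    ∃ g : E → 𝕜, AnalyticAt 𝕜 g z₀ ∧ ∀ᶠ z in 𝓝 z₀, (IsUnit (f z) ↔ g z ≠ 0) := by
  obtain ⟨N, hN, J, P, hu⟩ := exists_isUnit_add_comp_of_isCompactOperator_sub_one hcompact
  let M : E → X →L[𝕜] X := fun z ↦ f z + J.comp P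
  have hM : AnalyticAt 𝕜 M z₀ := hf.add analyticAt_const
  let R : E → X →L[𝕜] X := fun z ↦ Ring.inverse (M z)
  have hR : AnalyticAt 𝕜 R z₀ := by
    obtain ⟨u, hu⟩ := hu
    have h := analyticAt_inverse (𝕜 := 𝕜) u
    rw [hu] at h
    exact AnalyticAt.comp (f := M) h hM
  let D : E → N →L[𝕜] N := fun z ↦ 1 - P.comp ((R z).comp J)
  refine ⟨fun z ↦ LinearMap.det (D z : N →ₗ[𝕜] N), ?_, ?_⟩
  · let b := Module.finBasis 𝕜 N
    simp only [← LinearMap.det_toMatrix b]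
    refine AnalyticAt.matrix_det fun i j ↦ ?_
    let l : X →L[𝕜] 𝕜 := (LinearMap.toContinuousLinearMap (b.coord i)).comp P
    have hentry (z : E) : LinearMap.toMatrix b b (D z : N →ₗ[𝕜] N) i j =
        b.coord i (b j) - (l.comp (apply 𝕜 X (J (b j)))) (R z) := by
      simp [D, l, LinearMap.toMatrix_apply]
    simp only [hentry]
    exact analyticAt_const.sub ((ContinuousLinearMap.analyticAt _ _).comp hR)
  · filter_upwards [hM.continuousAt.eventually (Units.isOpen.mem_nhds hu)] with z hz
    have hz : IsUnit (M z) := hz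
    have hfactor : f z = M z * (1 - ((R z).comp J).comp P) := by
      have h : M z * (((R z).comp J).comp P) = J.comp P := by
        change M z * (R z * J.comp P) = _
        rw [← mul_assoc, Ring.mul_inverse_cancel _ hz, one_mul]
      rw [mul_sub, h, mul_one]
      exact (add_sub_cancel_right _ _).symm
    rw [hfactor, hz.mul_left_iff, isUnit_one_sub_comp_comm, isUnit_iff_det_ne_zero]

end AnalyticFamily

/-- Weak form of the generalized Analytic Fredholm Theorem: for an analytic family
`A : V → L(X,Y)` on a connected open `V ⊆ ℂⁿ` of operators admitting, at each point, an
invertible parametrix modulo compact operators, the set of points where `A z` is a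
continuous linear isomorphism is either empty, or open and dense in `V`. -/
theorem stmt2 (X Y : Type*)
    [NormedAddCommGroup X] [NormedSpace ℂ X] [CompleteSpace X]
    [NormedAddCommGroup Y] [NormedSpace ℂ Y] [CompleteSpace Y]
    (n : ℕ) (hn : 1 ≤ n)
    (V : Set (Fin n → ℂ)) (hV : IsOpen V) (hVconn : IsConnected V)
    (A : (Fin n → ℂ) → (X →L[ℂ] Y)) (hA : AnalyticOnNhd ℂ A V)
    (hpar : ∀ z ∈ V, ∃ B : Y ≃L[ℂ] X,
      IsCompactOperator ((B : Y →L[ℂ] X).comp (A z) - ContinuousLinearMap.id ℂ X)) :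
    {z ∈ V | ∃ e : X ≃L[ℂ] Y, (e : X →L[ℂ] Y) = A z} = ∅ ∨
      (IsOpen {z ∈ V | ∃ e : X ≃L[ℂ] Y, (e : X →L[ℂ] Y) = A z} ∧
        V ⊆ closure {z ∈ V | ∃ e : X ≃L[ℂ] Y, (e : X →L[ℂ] Y) = A z}) := by
  set G := {z ∈ V | ∃ e : X ≃L[ℂ] Y, (e : X →L[ℂ] Y) = A z}
  have hGopen : IsOpen G :=
    hA.continuousOn.isOpen_inter_preimage hV ContinuousLinearEquiv.isOpen
  have hmem {z : Fin n → ℂ} (hz : z ∈ V) (B : Y ≃L[ℂ] X) :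
      z ∈ G ↔ IsUnit ((B : Y →L[ℂ] X).comp (A z)) := by
    rw [isUnit_iff_isInvertible, isInvertible_equiv_comp]
    exact and_iff_right hz
  rcases G.eq_empty_or_nonempty with hG | ⟨w, hw⟩
  · exact .inl hG
  refine .inr ⟨hGopen, ?_⟩
  have hlocal : closure (interior (closure G)) ∩ V ⊆ interior (closure G) := by
    rintro z₀ ⟨hz₀, hz₀V⟩
    have hz₀ : z₀ ∈ closure G := closure_minimal interior_subset isClosed_closure hz₀
    obtain ⟨B, hB⟩ := hpar z₀ hz₀V
    have hBA : AnalyticAt ℂ (fun z ↦ (B : Y →L[ℂ] X).comp (A z)) z₀ :=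
      ((compL ℂ X Y X (B : Y →L[ℂ] X)).analyticAt _).comp (hA z₀ hz₀V)
    obtain ⟨g, hg, hgiff⟩ := hBA.exists_analyticAt_isUnit_iff_ne_zero hB
    obtain ⟨r, hr, hball⟩ := Metric.eventually_nhds_iff_ball.1
      (hg.eventually_analyticAt.and (hgiff.and (hV.mem_nhds hz₀V)))
    have hGiff {z : Fin n → ℂ} (hz : z ∈ Metric.ball z₀ r) : z ∈ G ↔ g z ≠ 0 :=
      (hmem (hball z hz).2.2 B).trans (hball z hz).2.1
    obtain ⟨y, hy, hyG⟩ := mem_closure_iff_nhds.1 hz₀ _ (Metric.ball_mem_nhds z₀ hr)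
    refine mem_interior.2 ⟨Metric.ball z₀ r, fun z hz ↦ ?_, Metric.isOpen_ball,
      Metric.mem_ball_self hr⟩
    by_contra hzG
    have hzero : g =ᶠ[𝓝 z] 0 := by
      filter_upwards [isClosed_closure.isOpen_compl.mem_nhds hzG,
        Metric.isOpen_ball.mem_nhds hz] with x hx hxball
      by_contra hgx
      exact hx (subset_closure ((hGiff hxball).2 hgx))
    have hganalytic : AnalyticOnNhd ℂ g (Metric.ball z₀ r) := fun x hx ↦ (hball x hx).1
    exact (hGiff hy).1 hyG (hganalytic.eqOn_zero_of_preconnected_of_eventuallyEq_zero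
      (convex_ball z₀ r).isPreconnected hz hzero hy)
  exact (hVconn.isPreconnected.subset_of_closure_inter_subset isOpen_interior
    ⟨w, hw.1, interior_mono subset_closure (hGopen.interior_eq.symm ▸ hw)⟩ hlocal).trans
    interior_subset
end

section
/- Let X be a complex Banach space, let Y and Z be normed complex vector spaces, let K : X → Z be a compact continuous linear operator, and let c ≥ 0. Let (T_m) be a sequence of continuous linear maps from X to Y converging in operator norm to T : X → Y, and suppose ‖x‖ ≤ c(‖K x‖ + ‖T_m x‖) for every m and every x ∈ X. If each T_m has nontrivial kernel, then T has nontrivial kernel. -/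
open Filter Topology in
/-- A Peetre-type estimate with respect to a compact operator `K` forces every bounded sequence
along which `T` tends to zero to have a convergent subsequence. -/
theorem IsCompactOperator.exists_tendsto_subseq_of_norm_le {𝕜 X Y Z : Type*}
    [NontriviallyNormedField 𝕜]
    [NormedAddCommGroup X] [NormedSpace 𝕜 X] [CompleteSpace X]
    [NormedAddCommGroup Y] [NormedSpace 𝕜 Y] [NormedAddCommGroup Z] [NormedSpace 𝕜 Z]
    {K : X →L[𝕜] Z} (hK : IsCompactOperator K) {T : X →L[𝕜] Y} {c : ℝ} (hc : 0 ≤ c)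
    (hest : ∀ x, ‖x‖ ≤ c * (‖K x‖ + ‖T x‖)) {u : ℕ → X} {r : ℝ} (hu : ∀ n, ‖u n‖ ≤ r)
    (hTu : Tendsto (fun n => T (u n)) atTop (𝓝 0)) :
    ∃ (x : X) (φ : ℕ → ℕ), StrictMono φ ∧ Tendsto (u ∘ φ) atTop (𝓝 x) := by
  obtain ⟨S, hS, hKS⟩ := IsCompactOperator.image_closedBall_subset_compact
    (f := (K : X →ₗ[𝕜] Z)) hK r
  obtain ⟨z, -, φ, hφ, hz⟩ := hS.tendsto_subseq (x := fun n => K (u n))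
    fun n => hKS ⟨u n, by simpa using hu n, rfl⟩
  have hP : AntilipschitzWith (2 * ⟨c, hc⟩ : NNReal) (K.prod T) :=
    (K.prod T).antilipschitz_of_bound fun x => by
      have h₁ : ‖K x‖ ≤ ‖K.prod T x‖ := norm_fst_le (K.prod T x)
      have h₂ : ‖T x‖ ≤ ‖K.prod T x‖ := norm_snd_le (K.prod T x)
      calc ‖x‖ ≤ c * (‖K x‖ + ‖T x‖) := hest x
        _ ≤ c * (‖K.prod T x‖ + ‖K.prod T x‖) := by gcongr
        _ = 2 * c * ‖K.prod T x‖ := by ring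
  have hemb := hP.isClosedEmbedding (K.prod T).uniformContinuous
  have hlim : Tendsto (K.prod T ∘ u ∘ φ) atTop (𝓝 (z, 0)) :=
    hz.prodMk_nhds (hTu.comp hφ.tendsto_atTop)
  obtain ⟨x, hx⟩ := hemb.isClosed_range.mem_of_tendsto hlim (.of_forall fun n => ⟨_, rfl⟩)
  exact ⟨x, φ, hφ, hemb.isInducing.tendsto_nhds_iff.2 (hx ▸ hlim)⟩

/-- If a sequence of operators `T_m` with nontrivial kernels converges in operator norm to
`T`, and a uniform estimate `‖x‖ ≤ c(‖K x‖ + ‖T_m x‖)` holds with a fixed compact operator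
`K`, then `T` has nontrivial kernel. -/
theorem stmt6 (X Y Z : Type*)
    [NormedAddCommGroup X] [NormedSpace ℂ X] [CompleteSpace X]
    [NormedAddCommGroup Y] [NormedSpace ℂ Y]
    [NormedAddCommGroup Z] [NormedSpace ℂ Z]
    (K : X →L[ℂ] Z) (hK : IsCompactOperator K)
    (c : ℝ) (hc : 0 ≤ c)
    (Tm : ℕ → (X →L[ℂ] Y)) (T : X →L[ℂ] Y)
    (hconv : Filter.Tendsto Tm Filter.atTop (nhds T))
    (hest : ∀ m : ℕ, ∀ x : X, ‖x‖ ≤ c * (‖K x‖ + ‖Tm m x‖))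
    (hker : ∀ m : ℕ, ∃ x : X, x ≠ 0 ∧ Tm m x = 0) :
    ∃ x : X, x ≠ 0 ∧ T x = 0 := by
  have hlim (x : X) : Filter.Tendsto (fun m => Tm m x) Filter.atTop (nhds (T x)) :=
    ((ContinuousLinearMap.apply ℂ Y x).continuous.tendsto T).comp hconv
  have hestT (x : X) : ‖x‖ ≤ c * (‖K x‖ + ‖T x‖) :=
    ge_of_tendsto' (((hlim x).norm.const_add _).const_mul c) fun m => hest m x
  have hunit (m : ℕ) : ∃ x : X, ‖x‖ = 1 ∧ Tm m x = 0 := by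
    obtain ⟨x, hx, hx0⟩ := hker m
    exact ⟨((‖x‖⁻¹ : ℝ) : ℂ) • x, by simp [norm_smul, hx], by simp [hx0]⟩
  choose u hu hu0 using hunit
  have hTu : Filter.Tendsto (fun m => T (u m)) Filter.atTop (nhds 0) := by
    refine squeeze_zero_norm (fun m => ?_) (tendsto_iff_norm_sub_tendsto_zero.1 hconv)
    simpa [hu, hu0] using (Tm m - T).le_opNorm (u m)
  obtain ⟨x, φ, hφ, hx⟩ :=
    hK.exists_tendsto_subseq_of_norm_le hc hestT (fun m => (hu m).le) hTu
  have hx1 : ‖x‖ = 1 := tendsto_nhds_unique hx.norm (by simp [hu])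
  exact ⟨x, norm_ne_zero_iff.1 (by simp [hx1]),
    tendsto_nhds_unique ((T.continuous.tendsto x).comp hx) (hTu.comp hφ.tendsto_atTop)⟩
end

section
/- Let N ≥ 1 and let c_{ij} : ℝ² → ℝ (1 ≤ i, j ≤ N) be C², ℤ²-periodic functions such that: (i) c_{ii}(x) ≥ 0 for all x and c_{ij}(x) ≤ 0 for all x whenever i ≠ j; (ii) Σ_{i=1}^N c_{ij}(x) ≥ 0 for every j and every x; (iii) there is no partition {1, …, N} = A ⊔ B into two nonempty sets with c_{ij} identically zero for all i ∈ A and j ∈ B. Let u₁, …, u_N : ℝ² → ℝ be C², ℤ²-periodic functions satisfying Δu_i = Σ_{j=1}^N c_{ij} u_j for every i, where Δ = ∂²/∂x² + ∂²/∂y², and suppose Σ_{i=1}^N u_i ≡ 0. Then u_i ≡ 0 for every i. -/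
/-- Second partial derivative of `f : ℝ × ℝ → ℝ` in the constant direction `v`. -/
noncomputable def secondDirDeriv (v : ℝ × ℝ) (f : ℝ × ℝ → ℝ) (p : ℝ × ℝ) : ℝ :=
  fderiv ℝ (fun q => fderiv ℝ f q v) p v

/-- The flat Laplacian `Δ = ∂²/∂x² + ∂²/∂y²` on `ℝ²`. -/
noncomputable def flatLaplacian (f : ℝ × ℝ → ℝ) (p : ℝ × ℝ) : ℝ :=
  secondDirDeriv (1, 0) f p + secondDirDeriv (0, 1) f p

open Filter Topology

section DirectionalDerivatives

variable {f g : ℝ × ℝ → ℝ}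

lemma ContDiff.differentiable_fderiv_apply_const (hf : ContDiff ℝ 2 f) (v : ℝ × ℝ) :
    Differentiable ℝ (fun q => fderiv ℝ f q v) := by
  have h : ContDiff ℝ 1 (fderiv ℝ f) := hf.fderiv_right (by norm_num)
  exact (h.differentiable (by norm_num)).clm_apply (differentiable_const v)

lemma hasDerivAt_comp_line (hf : Differentiable ℝ f) (p v : ℝ × ℝ) (t : ℝ) :
    HasDerivAt (fun s : ℝ => f (p + s • v)) (fderiv ℝ f (p + t • v) v) t := by
  have hl : HasDerivAt (fun s : ℝ => p + s • v) v t := by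
    simpa using ((hasDerivAt_id t).smul_const v).const_add p
  exact (hf (p + t • v)).hasFDerivAt.comp_hasDerivAt t hl

lemma deriv_comp_line (hf : Differentiable ℝ f) (p v : ℝ × ℝ) :
    deriv (fun s : ℝ => f (p + s • v)) = fun t => fderiv ℝ f (p + t • v) v :=
  funext fun t => (hasDerivAt_comp_line hf p v t).deriv

lemma secondDirDeriv_eq_deriv_deriv (hf : ContDiff ℝ 2 f) (p v : ℝ × ℝ) :
    secondDirDeriv v f p = deriv (deriv fun s : ℝ => f (p + s • v)) 0 := by
  rw [deriv_comp_line (hf.differentiable (by norm_num))]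
  have h := (hasDerivAt_comp_line (hf.differentiable_fderiv_apply_const v) p v 0).deriv
  rw [h]
  simp [secondDirDeriv]

lemma secondDirDeriv_sub (hf : ContDiff ℝ 2 f) (hg : ContDiff ℝ 2 g) (v p : ℝ × ℝ) :
    secondDirDeriv v (fun x => f x - g x) p = secondDirDeriv v f p - secondDirDeriv v g p := by
  have hf1 := hf.differentiable (by norm_num : (2 : WithTop ℕ∞) ≠ 0)
  have hg1 := hg.differentiable (by norm_num : (2 : WithTop ℕ∞) ≠ 0)
  unfold secondDirDeriv
  have h : (fun q => fderiv ℝ (fun x => f x - g x) q v)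
      = fun q => fderiv ℝ f q v - fderiv ℝ g q v := by
    funext q
    rw [fderiv_fun_sub (hf1 q) (hg1 q)]
    rfl
  rw [h, fderiv_fun_sub (hf.differentiable_fderiv_apply_const v p)
    (hg.differentiable_fderiv_apply_const v p)]
  rfl

lemma fderiv_sum_const_mul {ι : Type*} [Fintype ι] (a : ι → ℝ) {u : ι → ℝ × ℝ → ℝ}
    (hu : ∀ i, Differentiable ℝ (u i)) (p : ℝ × ℝ) :
    fderiv ℝ (fun x => ∑ i, a i * u i x) p = ∑ i, a i • fderiv ℝ (u i) p := by
  rw [fderiv_fun_sum fun i _ => (hu i p).const_mul (a i)]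
  exact Finset.sum_congr rfl fun i _ => fderiv_const_mul (hu i p) (a i)

lemma secondDirDeriv_sum_const_mul {ι : Type*} [Fintype ι] (a : ι → ℝ) {u : ι → ℝ × ℝ → ℝ}
    (hu : ∀ i, ContDiff ℝ 2 (u i)) (v p : ℝ × ℝ) :
    secondDirDeriv v (fun x => ∑ i, a i * u i x) p = ∑ i, a i * secondDirDeriv v (u i) p := by
  unfold secondDirDeriv
  have h : (fun q => fderiv ℝ (fun x => ∑ i, a i * u i x) q v)
      = fun q => ∑ i, a i * fderiv ℝ (u i) q v := by
    funext q
    rw [fderiv_sum_const_mul a fun i => (hu i).differentiable (by norm_num)]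
    simp
  rw [h, fderiv_sum_const_mul a fun i => (hu i).differentiable_fderiv_apply_const v]
  simp

lemma flatLaplacian_sub (hf : ContDiff ℝ 2 f) (hg : ContDiff ℝ 2 g) (p : ℝ × ℝ) :
    flatLaplacian (fun x => f x - g x) p = flatLaplacian f p - flatLaplacian g p := by
  simp only [flatLaplacian, secondDirDeriv_sub hf hg]
  ring

lemma flatLaplacian_sum_const_mul {ι : Type*} [Fintype ι] (a : ι → ℝ) {u : ι → ℝ × ℝ → ℝ}
    (hu : ∀ i, ContDiff ℝ 2 (u i)) (p : ℝ × ℝ) :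
    flatLaplacian (fun x => ∑ i, a i * u i x) p = ∑ i, a i * flatLaplacian (u i) p := by
  simp only [flatLaplacian, secondDirDeriv_sum_const_mul a hu, mul_add, Finset.sum_add_distrib]

lemma IsLocalMin.secondDirDeriv_nonneg (hf : ContDiff ℝ 2 f) {p : ℝ × ℝ} (h : IsLocalMin f p)
    (v : ℝ × ℝ) : 0 ≤ secondDirDeriv v f p := by
  rw [secondDirDeriv_eq_deriv_deriv hf]
  by_contra! hneg
  set l : ℝ → ℝ := fun s => f (p + s • v) with hl
  have hcont : Continuous fun s : ℝ => p + s • v := by fun_prop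
  have hmin : IsLocalMin l 0 := by
    have ht : Tendsto (fun s : ℝ => p + s • v) (𝓝 0) (𝓝 p) := by
      simpa using hcont.tendsto 0
    have := ht.eventually h
    filter_upwards [this] with s hs
    simpa [hl] using hs
  have hmax : IsLocalMax l 0 :=
    isLocalMax_of_deriv_deriv_neg hneg hmin.deriv_eq_zero
      (hf.continuous.comp hcont).continuousAt
  have hconst : l =ᶠ[𝓝 0] fun _ => l 0 := by
    filter_upwards [hmin, hmax] with s h1 h2 using le_antisymm h2 h1
  have := hconst.deriv.deriv_eq
  simp at this
  exact hneg.ne this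

lemma IsLocalMin.flatLaplacian_nonneg (hf : ContDiff ℝ 2 f) {p : ℝ × ℝ} (h : IsLocalMin f p) :
    0 ≤ flatLaplacian f p :=
  add_nonneg (h.secondDirDeriv_nonneg hf _) (h.secondDirDeriv_nonneg hf _)

end DirectionalDerivatives

/-- The radial Gaussian `m (exp (-α |x - b|²) - κ)` used as a barrier. -/
noncomputable def gaussianBarrier (m α κ : ℝ) (b x : ℝ × ℝ) : ℝ :=
  m * (Real.exp (-(α * ((x.1 - b.1) ^ 2 + (x.2 - b.2) ^ 2))) - κ)

section GaussianBarrier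

variable (m α κ : ℝ) (b : ℝ × ℝ)

lemma contDiff_gaussianBarrier : ContDiff ℝ 2 (gaussianBarrier m α κ b) := by
  unfold gaussianBarrier
  fun_prop

lemma hasDerivAt_gaussianBarrier_line (p v : ℝ × ℝ) (t : ℝ) :
    HasDerivAt (fun s : ℝ => gaussianBarrier m α κ b (p + s • v))
      (m * (Real.exp (-(α * ((p.1 + t * v.1 - b.1) ^ 2 + (p.2 + t * v.2 - b.2) ^ 2))) *
        -(α * (2 * (p.1 + t * v.1 - b.1) * v.1 + 2 * (p.2 + t * v.2 - b.2) * v.2)))) t := by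
  have hlin : ∀ x y c : ℝ, HasDerivAt (fun s : ℝ => (x + s * y - c) ^ 2)
      (2 * (x + t * y - c) * y) t := fun x y c => by
    simpa using ((((hasDerivAt_id t).mul_const y).const_add x).sub_const c).fun_pow 2
  exact ((((hlin p.1 v.1 b.1).add
    (hlin p.2 v.2 b.2)).const_mul α).neg.exp.sub_const κ).const_mul m

lemma fderiv_gaussianBarrier_apply (p v : ℝ × ℝ) :
    fderiv ℝ (gaussianBarrier m α κ b) p v =
      m * (Real.exp (-(α * ((p.1 - b.1) ^ 2 + (p.2 - b.2) ^ 2))) *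
        -(α * (2 * (p.1 - b.1) * v.1 + 2 * (p.2 - b.2) * v.2))) := by
  have h1 := hasDerivAt_comp_line
    ((contDiff_gaussianBarrier m α κ b).differentiable (by norm_num)) p v 0
  have h2 := h1.unique (hasDerivAt_gaussianBarrier_line m α κ b p v 0)
  simpa using h2

lemma secondDirDeriv_gaussianBarrier (p v : ℝ × ℝ) :
    secondDirDeriv v (gaussianBarrier m α κ b) p =
      m * Real.exp (-(α * ((p.1 - b.1) ^ 2 + (p.2 - b.2) ^ 2))) *
        ((α * (2 * (p.1 - b.1) * v.1 + 2 * (p.2 - b.2) * v.2)) ^ 2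
          - 2 * α * (v.1 ^ 2 + v.2 ^ 2)) := by
  rw [secondDirDeriv_eq_deriv_deriv (contDiff_gaussianBarrier m α κ b)]
  have h : deriv (fun s : ℝ => gaussianBarrier m α κ b (p + s • v)) = fun t =>
      m * (Real.exp (-(α * ((p.1 + t * v.1 - b.1) ^ 2 + (p.2 + t * v.2 - b.2) ^ 2))) *
        -(α * (2 * (p.1 + t * v.1 - b.1) * v.1 + 2 * (p.2 + t * v.2 - b.2) * v.2))) :=
    funext fun t => (hasDerivAt_gaussianBarrier_line m α κ b p v t).deriv
  rw [h]
  have hlin : ∀ x y c : ℝ, HasDerivAt (fun s : ℝ => x + s * y - c) y 0 := fun x y c => by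
    simpa using (((hasDerivAt_id (0 : ℝ)).mul_const y).const_add x).sub_const c
  have h1 := (((hlin p.1 v.1 b.1).pow 2).add ((hlin p.2 v.2 b.2).pow 2)).const_mul α |>.neg.exp
  have h2 := (((((hlin p.1 v.1 b.1).const_mul 2).mul_const v.1).add
    (((hlin p.2 v.2 b.2).const_mul 2).mul_const v.2)).const_mul α).neg
  refine ((h1.mul h2).const_mul m).deriv.trans ?_
  simp
  ring

lemma flatLaplacian_gaussianBarrier (p : ℝ × ℝ) :
    flatLaplacian (gaussianBarrier m α κ b) p =
      m * Real.exp (-(α * ((p.1 - b.1) ^ 2 + (p.2 - b.2) ^ 2))) *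
        (4 * α ^ 2 * ((p.1 - b.1) ^ 2 + (p.2 - b.2) ^ 2) - 4 * α) := by
  simp only [flatLaplacian, secondDirDeriv_gaussianBarrier]
  ring

end GaussianBarrier

lemma isCompact_setOf_sq_le (b : ℝ × ℝ) (r : ℝ) :
    IsCompact {x : ℝ × ℝ | (x.1 - b.1) ^ 2 + (x.2 - b.2) ^ 2 ≤ r} := by
  refine (isCompact_closedBall b (Real.sqrt r)).of_isClosed_subset
    (isClosed_le (by fun_prop) continuous_const) fun x hx => ?_
  simp only [Set.mem_ofPred_eq] at hx
  rw [Metric.mem_closedBall, Prod.dist_eq, Real.dist_eq, Real.dist_eq]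
  exact max_le (Real.abs_le_sqrt (by nlinarith [sq_nonneg (x.2 - b.2)]))
    (Real.abs_le_sqrt (by nlinarith [sq_nonneg (x.1 - b.1)]))

/-- Strong minimum principle in viscosity form: a nonnegative continuous `w` with `Δw ≤ k w`,
tested only with smooth functions whose gradient does not vanish at the contact point,
vanishes identically as soon as it vanishes somewhere. -/
theorem eq_zero_of_viscosity_supersolution {w k : ℝ × ℝ → ℝ} (hw : Continuous w)
    (hk : Continuous k) (hw0 : ∀ x, 0 ≤ w x)
    (H : ∀ φ : ℝ × ℝ → ℝ, ContDiff ℝ 2 φ → ∀ p, fderiv ℝ φ p ≠ 0 →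
      IsLocalMin (fun x => w x - φ x) p → flatLaplacian φ p ≤ k p * w p)
    {a : ℝ × ℝ} (ha : w a = 0) (b : ℝ × ℝ) : w b = 0 := by
  by_contra hb
  set ρ : ℝ × ℝ → ℝ := fun x => (x.1 - b.1) ^ 2 + (x.2 - b.2) ^ 2 with hρ
  have hρc : Continuous ρ := by fun_prop
  have hρ0 : ∀ x, 0 ≤ ρ x := fun x => by positivity
  obtain ⟨z, ⟨hza, hz⟩, hzmin⟩ := ((isCompact_setOf_sq_le b (ρ a)).inter_right
    (isClosed_eq hw continuous_const)).exists_isMinOn ⟨a, le_refl (ρ a), ha⟩ hρc.continuousOn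
  have hz : w z = 0 := hz
  have hpos : ∀ x, ρ x < ρ z → 0 < w x := fun x hx => by
    refine (hw0 x).lt_of_ne' fun h0 => ?_
    have : ρ z ≤ ρ x := hzmin ⟨hx.le.trans hza, h0⟩
    linarith
  have hR : 0 < ρ z := by
    refine (hρ0 z).lt_of_ne' fun h0 => hb ?_
    have h1 : z.1 - b.1 = 0 := by
      have : (z.1 - b.1) ^ 2 + (z.2 - b.2) ^ 2 = 0 := h0
      nlinarith [sq_nonneg (z.1 - b.1), sq_nonneg (z.2 - b.2)]
    have h2 : z.2 - b.2 = 0 := by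
      have : (z.1 - b.1) ^ 2 + (z.2 - b.2) ^ 2 = 0 := h0
      nlinarith [sq_nonneg (z.1 - b.1), sq_nonneg (z.2 - b.2)]
    rwa [← Prod.ext (sub_eq_zero.1 h1) (sub_eq_zero.1 h2)]
  have hdisk := isCompact_setOf_sq_le b (4 * ρ z)
  obtain ⟨K, hK0, hK⟩ : ∃ K, 0 ≤ K ∧ ∀ x, ρ x ≤ 4 * ρ z → k x ≤ K := by
    obtain ⟨C, hC⟩ := hdisk.bddAbove_image hk.continuousOn
    exact ⟨max C 0, le_max_right _ _,
      fun x hx => (hC (Set.mem_image_of_mem k hx)).trans (le_max_left _ _)⟩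
  obtain ⟨m, hm, hmw⟩ : ∃ m, 0 < m ∧ ∀ x, ρ x = ρ z / 4 → m ≤ w x := by
    have hcirc : IsCompact {x | ρ x = ρ z / 4} := (hdisk.of_isClosed_subset
      (isClosed_eq hρc continuous_const) fun x hx => by
        have hx : ρ x = ρ z / 4 := hx
        change ρ x ≤ 4 * ρ z
        linarith)
    obtain hne | hne := {x | ρ x = ρ z / 4}.eq_empty_or_nonempty
    · exact ⟨1, one_pos, fun x hx => absurd hx (Set.eq_empty_iff_forall_notMem.1 hne x)⟩
    · obtain ⟨y, hy, hymin⟩ := hcirc.exists_isMinOn hne hw.continuousOn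
      have hy : ρ y = ρ z / 4 := hy
      exact ⟨w y, hpos y (by linarith), fun x hx => hymin hx⟩
  obtain ⟨α, hα, hαR⟩ : ∃ α : ℝ, 1 ≤ α ∧ 5 + K ≤ α * ρ z := by
    refine ⟨1 + (5 + K) / ρ z, ?_, ?_⟩
    · have : 0 ≤ (5 + K) / ρ z := by positivity
      linarith
    · rw [add_mul, div_mul_cancel₀ _ hR.ne']
      linarith
  set κ := Real.exp (-(α * ρ z)) with hκ
  set φ := gaussianBarrier m α κ b with hφdef
  have hφ : ContDiff ℝ 2 φ := contDiff_gaussianBarrier m α κ b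
  have hφx : ∀ x, φ x = m * (Real.exp (-(α * ρ x)) - κ) := fun x => rfl
  have hκ0 : 0 < κ := Real.exp_pos _
  have hann : IsCompact {x | ρ z / 4 ≤ ρ x ∧ ρ x ≤ 4 * ρ z} :=
    hdisk.of_isClosed_subset ((isClosed_le continuous_const hρc).inter
      (isClosed_le hρc continuous_const)) fun x hx => hx.2
  have hzA : z ∈ {x | ρ z / 4 ≤ ρ x ∧ ρ x ≤ 4 * ρ z} := ⟨by linarith, by linarith⟩
  obtain ⟨p, ⟨hp1, hp2⟩, hpmin⟩ := hann.exists_isMinOn ⟨z, hzA⟩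
    (hw.sub hφ.continuous).continuousOn
  have hple : w p - φ p ≤ 0 := by
    have h : w p - φ p ≤ w z - φ z := hpmin hzA
    rw [hz, hφx z, hκ] at h
    simpa using h
  have hp1' : ρ z / 4 < ρ p := by
    refine hp1.lt_of_ne fun h => ?_
    have h1 := hmw p h.symm
    have h2 : Real.exp (-(α * ρ p)) ≤ 1 := by
      rw [Real.exp_le_one_iff]
      have := mul_nonneg (zero_le_one.trans hα) (hρ0 p)
      linarith
    rw [hφx p] at hple
    nlinarith
  have hp2' : ρ p ≤ ρ z := by
    by_contra! h
    have h1 : Real.exp (-(α * ρ p)) < κ := by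
      rw [hκ, Real.exp_lt_exp]
      nlinarith
    rw [hφx p] at hple
    nlinarith [hw0 p]
  have hloc : IsLocalMin (fun x => w x - φ x) p := by
    have h1 : ∀ᶠ x in 𝓝 p, ρ z / 4 < ρ x := hρc.continuousAt.eventually (lt_mem_nhds hp1')
    have h2 : ∀ᶠ x in 𝓝 p, ρ x < 4 * ρ z :=
      hρc.continuousAt.eventually (gt_mem_nhds (by linarith))
    filter_upwards [h1, h2] with x hx1 hx2 using hpmin ⟨hx1.le, hx2.le⟩
  have hE : 0 < m * Real.exp (-(α * ρ p)) := mul_pos hm (Real.exp_pos _)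
  have hgrad : fderiv ℝ φ p ≠ 0 := by
    intro h0
    have h := fderiv_gaussianBarrier_apply m α κ b p (p - b)
    change fderiv ℝ φ p (p - b) = m * (Real.exp (-(α * ρ p)) * _) at h
    rw [h0] at h
    have h' : (m * Real.exp (-(α * ρ p))) * (2 * (α * ρ p)) = 0 := by
      simp only [zero_apply, Prod.fst_sub, Prod.snd_sub] at h
      simp only [hρ] at h ⊢
      linarith
    have : 0 < α * ρ p := mul_pos (by linarith) (by linarith)
    exact (mul_pos hE (mul_pos two_pos this)).ne' h'
  have hlap := H φ hφ p hgrad hloc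
  have hlap' : flatLaplacian φ p =
    m * Real.exp (-(α * ρ p)) * (4 * α ^ 2 * ρ p - 4 * α) :=
    flatLaplacian_gaussianBarrier m α κ b p
  have hwE : w p ≤ m * Real.exp (-(α * ρ p)) := by
    rw [hφx p] at hple
    nlinarith
  have hle : m * Real.exp (-(α * ρ p)) * (4 * α ^ 2 * ρ p - 4 * α) ≤
      m * Real.exp (-(α * ρ p)) * K := by
    rw [← hlap', mul_comm _ K]
    exact hlap.trans ((mul_le_mul_of_nonneg_right (hK p hp2) (hw0 p)).trans
      (mul_le_mul_of_nonneg_left hwE hK0))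
  have hle' := le_of_mul_le_mul_left hle hE
  have h4 : α * (α * ρ z) < α * (4 * (α * ρ p)) :=
    mul_lt_mul_of_pos_left (by nlinarith) (by linarith)
  nlinarith

lemma Continuous.exists_forall_le_of_int_periodic {f : ℝ × ℝ → ℝ} (hf : Continuous f)
    (hper : ∀ (p : ℝ × ℝ) (m k : ℤ), f (p.1 + (m : ℝ), p.2 + (k : ℝ)) = f p) :
    ∃ a, ∀ x, f x ≤ f a := by
  obtain ⟨a, -, ha⟩ := ((isCompact_Icc (a := (0 : ℝ)) (b := 1)).prod
    (isCompact_Icc (a := (0 : ℝ)) (b := 1))).exists_isMaxOn ⟨(0, 0), by simp⟩ hf.continuousOn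
  refine ⟨a, fun x => ?_⟩
  rw [← hper x (-⌊x.1⌋) (-⌊x.2⌋)]
  refine ha ⟨⟨?_, ?_⟩, ?_, ?_⟩ <;> push_cast
  · linarith [Int.floor_le x.1]
  · linarith [Int.lt_floor_add_one x.1]
  · linarith [Int.floor_le x.2]
  · linarith [Int.lt_floor_add_one x.2]

lemma hasFDerivAt_max_zero_of_nonpos {f : ℝ × ℝ → ℝ} {p : ℝ × ℝ}
    (hf : DifferentiableAt ℝ f p) (hp : f p ≤ 0) (h0 : f p = 0 → fderiv ℝ f p = 0) :
    HasFDerivAt (fun x => max (f x) 0) (0 : ℝ × ℝ →L[ℝ] ℝ) p := by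
  obtain hp | hp := hp.lt_or_eq
  · refine (hasFDerivAt_const (0 : ℝ) p).congr_of_eventuallyEq ?_
    filter_upwards [hf.continuousAt.eventually (gt_mem_nhds hp)] with x hx
    exact max_eq_right hx.le
  · have h := hf.hasFDerivAt
    rw [h0 hp, hasFDerivAt_iff_isLittleO] at h
    rw [hasFDerivAt_iff_isLittleO]
    refine (Asymptotics.isBigO_of_le _ fun x => ?_).trans_isLittleO h
    simp only [hp, max_self, sub_zero, zero_apply, Real.norm_eq_abs]
    rw [abs_of_nonneg (le_max_right _ _)]
    exact max_le (le_abs_self _) (abs_nonneg _)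

section CooperativeSystem

variable {ι : Type*}

lemma exists_sign (y : ℝ) : ∃ s : ℝ, |s| = 1 ∧ s * y = |y| := by
  obtain h | h := le_total 0 y
  · exact ⟨1, by simp, by simp [abs_of_nonneg h]⟩
  · exact ⟨-1, by simp, by simp [abs_of_nonpos h]⟩

lemma exists_sign_eq (y : ι → ℝ) (i : ι) {t : ℝ} (ht : |t| = 1) (hty : t * y i = |y i|) :
    ∃ s : ι → ℝ, (∀ j, |s j| = 1) ∧ (∀ j, s j * y j = |y j|) ∧ s i = t := by
  classical
  choose s hs hsy using fun j => exists_sign (y j)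
  refine ⟨Function.update s i t, fun j => ?_, fun j => ?_, by simp⟩ <;>
  · obtain rfl | hj := eq_or_ne j i <;> simp_all

lemma mul_abs_le_sign_mul_mul {C : ι → ι → ℝ} (hoff : ∀ i j, i ≠ j → C i j ≤ 0) {y s : ι → ℝ}
    (hs : ∀ i, |s i| = 1) (hsy : ∀ i, s i * y i = |y i|) (i j : ι) :
    C i j * |y j| ≤ s i * (C i j * y j) := by
  obtain rfl | hij := eq_or_ne i j
  · rw [← hsy i]
    exact le_of_eq (by ring)
  · have h : s i * y j ≤ |y j| := by
      have := le_abs_self (s i * y j)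
      rwa [abs_mul, hs i, one_mul] at this
    have := mul_le_mul_of_nonpos_left h (hoff i j hij)
    linarith

variable [Fintype ι]

lemma sum_sum_mul_abs_nonneg {C : ι → ι → ℝ} (hdom : ∀ j, 0 ≤ ∑ i, C i j) (y : ι → ℝ) :
    0 ≤ ∑ i, ∑ j, C i j * |y j| := by
  rw [Finset.sum_comm]
  refine Finset.sum_nonneg fun j _ => ?_
  rw [← Finset.sum_mul]
  exact mul_nonneg (hdom j) (abs_nonneg _)

lemma sum_sum_mul_abs_le {C : ι → ι → ℝ} (hoff : ∀ i j, i ≠ j → C i j ≤ 0) {y s : ι → ℝ}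
    (hs : ∀ i, |s i| = 1) (hsy : ∀ i, s i * y i = |y i|) :
    ∑ i, ∑ j, C i j * |y j| ≤ ∑ i, s i * ∑ j, C i j * y j := by
  simp only [Finset.mul_sum]
  exact Finset.sum_le_sum fun i _ => Finset.sum_le_sum fun j _ =>
    mul_abs_le_sign_mul_mul hoff hs hsy i j

lemma sign_mul_mul_eq_mul_abs {C : ι → ι → ℝ} (hoff : ∀ i j, i ≠ j → C i j ≤ 0)
    (hdom : ∀ j, 0 ≤ ∑ i, C i j) {y s : ι → ℝ}
    (hs : ∀ i, |s i| = 1) (hsy : ∀ i, s i * y i = |y i|)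
    (hle : ∑ i, s i * ∑ j, C i j * y j ≤ 0) (i j : ι) :
    s i * (C i j * y j) = C i j * |y j| := by
  have hterm := mul_abs_le_sign_mul_mul hoff hs hsy
  have heq : ∑ i, ∑ j, C i j * |y j| = ∑ i, ∑ j, s i * (C i j * y j) := by
    refine le_antisymm (Finset.sum_le_sum fun i _ => Finset.sum_le_sum fun j _ => hterm i j) ?_
    simp only [Finset.mul_sum] at hle
    exact hle.trans (sum_sum_mul_abs_nonneg hdom y)
  have hrow := (Finset.sum_eq_sum_iff_of_le fun i _ =>
    Finset.sum_le_sum fun j _ => hterm i j).1 heq i (Finset.mem_univ i)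
  exact ((Finset.sum_eq_sum_iff_of_le fun j _ => hterm i j).1 hrow j (Finset.mem_univ j)).symm

lemma sum_sign_mul_le {s : ι → ℝ} (hs : ∀ i, |s i| = 1) (y : ι → ℝ) :
    ∑ i, s i * y i ≤ ∑ i, |y i| :=
  Finset.sum_le_sum fun i _ => (le_abs_self _).trans (by rw [abs_mul, hs i, one_mul])

variable {c : ι → ι → ℝ × ℝ → ℝ} {u : ι → ℝ × ℝ → ℝ}

/-- For a periodic solution of a cooperative, column-diagonally dominant system, the function
`∑ i, |u i|` is constant. -/
lemma exists_sum_abs_eq_const (hoff : ∀ i j, i ≠ j → ∀ p, c i j p ≤ 0)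
    (hdom : ∀ j p, 0 ≤ ∑ i, c i j p) (hu : ∀ i, ContDiff ℝ 2 (u i))
    (hper : ∀ i (p : ℝ × ℝ) (m k : ℤ), u i (p.1 + (m : ℝ), p.2 + (k : ℝ)) = u i p)
    (heq : ∀ i p, flatLaplacian (u i) p = ∑ j, c i j p * u j p) :
    ∃ M, ∀ p, ∑ i, |u i p| = M := by
  have hWc : Continuous fun p => ∑ i, |u i p| :=
    continuous_finsetSum _ fun i _ => (hu i).continuous.abs
  obtain ⟨a, ha⟩ := hWc.exists_forall_le_of_int_periodic fun p m k => by simp only [hper]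
  refine ⟨∑ i, |u i a|, fun p => ?_⟩
  have key := eq_zero_of_viscosity_supersolution
    (w := fun p => ∑ i, |u i a| - ∑ i, |u i p|) (k := fun _ => 0)
    (continuous_const.sub hWc) continuous_const (fun x => sub_nonneg.2 (ha x)) ?_ (sub_self _) p
  · exact (sub_eq_zero.1 key).symm
  intro φ hφ p _ hmin
  choose s hs hsy using fun i => exists_sign (u i p)
  have hS : ContDiff ℝ 2 fun x => ∑ i, (-s i) * u i x :=
    ContDiff.sum fun i _ => contDiff_const.mul (hu i)
  have hmin' : IsLocalMin (fun x => (∑ i, (-s i) * u i x) - φ x) p := by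
    filter_upwards [hmin] with x hx
    have h1 := sum_sign_mul_le hs fun i => u i x
    have h2 : ∑ i, s i * u i p = ∑ i, |u i p| := Finset.sum_congr rfl fun i _ => hsy i
    simp only [neg_mul, Finset.sum_neg_distrib]
    linarith
  have h := hmin'.flatLaplacian_nonneg (hS.sub hφ)
  rw [flatLaplacian_sub hS hφ, flatLaplacian_sum_const_mul _ hu] at h
  simp only [heq, neg_mul, Finset.sum_neg_distrib] at h
  have h1 := sum_sum_mul_abs_nonneg (C := fun i j => c i j p) (hdom · p) fun i => u i p
  have h2 := sum_sum_mul_abs_le (C := fun i j => c i j p) (fun i j hij => hoff i j hij p) hs hsy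
  linarith

/-- When `∑ i, |u i|` is constant, every signed sum touching it from below is critical with
nonpositive Laplacian at the contact point. -/
lemma signed_sum_of_sum_abs_eq_const (hu : ∀ i, ContDiff ℝ 2 (u i)) {M : ℝ}
    (hM : ∀ p, ∑ i, |u i p| = M) {p : ℝ × ℝ} {s : ι → ℝ} (hs : ∀ i, |s i| = 1)
    (hsy : ∀ i, s i * u i p = |u i p|) :
    (∀ v, ∑ i, s i * fderiv ℝ (u i) p v = 0) ∧ ∑ i, s i * flatLaplacian (u i) p ≤ 0 := by
  have hS : ContDiff ℝ 2 fun x => ∑ i, (-s i) * u i x :=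
    ContDiff.sum fun i _ => contDiff_const.mul (hu i)
  have hmin : IsLocalMin (fun x => ∑ i, (-s i) * u i x) p := by
    refine Eventually.of_forall fun x => ?_
    have h1 := sum_sign_mul_le hs fun i => u i x
    have h2 : ∑ i, s i * u i p = ∑ i, |u i p| := Finset.sum_congr rfl fun i _ => hsy i
    simp only [neg_mul, Finset.sum_neg_distrib]
    linarith [hM x, hM p]
  have h1 := hmin.fderiv_eq_zero
  rw [fderiv_sum_const_mul _ fun i => (hu i).differentiable (by norm_num)] at h1
  have h2 := hmin.flatLaplacian_nonneg hS
  rw [flatLaplacian_sum_const_mul _ hu] at h2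
  constructor
  · intro v
    simpa using congrArg (fun L : ℝ × ℝ →L[ℝ] ℝ => L v) h1
  · simpa using h2

lemma fderiv_eq_zero_of_sum_abs_eq_const (hu : ∀ i, ContDiff ℝ 2 (u i)) {M : ℝ}
    (hM : ∀ p, ∑ i, |u i p| = M) {p : ℝ × ℝ} {i : ι} (hi : u i p = 0) :
    fderiv ℝ (u i) p = 0 := by
  classical
  choose s hs hsy using fun j => exists_sign (u j p)
  refine ContinuousLinearMap.ext fun v => ?_
  have hflip : ∀ t : ℝ, |t| = 1 →
      t * fderiv ℝ (u i) p v + ∑ j ∈ Finset.univ \ {i}, s j * fderiv ℝ (u j) p v = 0 := by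
    intro t ht
    have h := (signed_sum_of_sum_abs_eq_const hu hM (s := Function.update s i t) (p := p)
      (fun j => by obtain rfl | hj := eq_or_ne j i <;> simp_all)
      (fun j => by obtain rfl | hj := eq_or_ne j i <;> simp_all)).1 v
    rw [← h, Finset.sum_eq_add_sum_sdiff_singleton_of_mem (Finset.mem_univ i)]
    congr 1
    · simp
    · refine Finset.sum_congr rfl fun j hj => ?_
      have hj : j ≠ i := by simpa using hj
      simp [hj]
  have h1 := hflip 1 (by simp)
  have h2 := hflip (-1) (by simp)
  rw [zero_apply]
  linarith

/-- For a periodic solution, each component that is positive somewhere is positive everywhere. -/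
lemma pos_of_exists_pos (hc : ∀ i, Continuous (c i i))
    (hoff : ∀ i j, i ≠ j → ∀ p, c i j p ≤ 0) (hu : ∀ i, ContDiff ℝ 2 (u i))
    (heq : ∀ i p, flatLaplacian (u i) p = ∑ j, c i j p * u j p) {M : ℝ}
    (hM : ∀ p, ∑ i, |u i p| = M)
    (hsign : ∀ i p (t : ℝ), |t| = 1 → t * u i p = |u i p| →
      ∀ j, t * (c i j p * u j p) = c i j p * |u j p|)
    {i : ι} {b : ℝ × ℝ} (hb : 0 < u i b) (p : ℝ × ℝ) : 0 < u i p := by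
  by_contra! hp
  refine hb.not_ge (max_eq_right_iff.1 ?_)
  refine eq_zero_of_viscosity_supersolution (w := fun x => max (u i x) 0) (k := c i i)
    ((hu i).continuous.max continuous_const) (hc i) (fun x => le_max_right _ _) ?_
    (max_eq_right hp) b
  intro φ hφ q hgrad hmin
  have hφd : DifferentiableAt ℝ φ q := hφ.differentiable (by norm_num) q
  have hud : DifferentiableAt ℝ (u i) q := (hu i).differentiable (by norm_num) q
  obtain hq | hq := le_or_gt (u i q) 0
  · have h := hasFDerivAt_max_zero_of_nonpos hud hq
      fun h => fderiv_eq_zero_of_sum_abs_eq_const hu hM h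
    have h0 := hmin.hasFDerivAt_eq_zero (h.sub hφd.hasFDerivAt)
    exact absurd (by simpa using h0) hgrad
  · have hmin' : IsLocalMin (fun x => u i x - φ x) q := by
      filter_upwards [hmin, hud.continuousAt.eventually (lt_mem_nhds hq)] with x hx hx0
      simpa only [max_eq_left hx0.le, max_eq_left hq.le] using hx
    have h := hmin'.flatLaplacian_nonneg ((hu i).sub hφ)
    rw [flatLaplacian_sub (hu i) hφ, heq] at h
    rw [max_eq_left hq.le]
    have hsum : ∑ j, c i j q * u j q ≤ c i i q * u i q := by
      classical
      rw [Finset.sum_eq_add_sum_sdiff_singleton_of_mem (Finset.mem_univ i), add_le_iff_nonpos_right]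
      refine Finset.sum_nonpos fun j hj => ?_
      have hj : i ≠ j := by
        rintro rfl
        simp at hj
      have h1 := hsign i q 1 (by simp) (by rw [abs_of_pos hq, one_mul]) j
      rw [one_mul] at h1
      rw [h1]
      exact mul_nonpos_of_nonpos_of_nonneg (hoff i j hj q) (abs_nonneg _)
    linarith

end CooperativeSystem

/-- Maximum principle for cooperative, column-diagonally dominant, fully coupled elliptic
systems on the torus: if `Δu_i = Σ_j c_{ij} u_j` with `ℤ²`-periodic data and
`Σ_i u_i ≡ 0`, then every `u_i` vanishes identically. -/
theorem stmt7 (N : ℕ) (hN : 1 ≤ N)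
    (c : Fin N → Fin N → (ℝ × ℝ) → ℝ)
    (hc_smooth : ∀ i j, ContDiff ℝ 2 (c i j))
    (hc_per : ∀ i j (p : ℝ × ℝ) (m k : ℤ), c i j (p.1 + (m : ℝ), p.2 + (k : ℝ)) = c i j p)
    (hcoop_diag : ∀ i p, 0 ≤ c i i p)
    (hcoop_off : ∀ i j, i ≠ j → ∀ p, c i j p ≤ 0)
    (hdom : ∀ j p, 0 ≤ ∑ i, c i j p)
    (hcoupled : ¬ ∃ A B : Set (Fin N), A.Nonempty ∧ B.Nonempty ∧ A ∪ B = Set.univ ∧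
        Disjoint A B ∧ ∀ i ∈ A, ∀ j ∈ B, ∀ p, c i j p = 0)
    (u : Fin N → (ℝ × ℝ) → ℝ)
    (hu_smooth : ∀ i, ContDiff ℝ 2 (u i))
    (hu_per : ∀ i (p : ℝ × ℝ) (m k : ℤ), u i (p.1 + (m : ℝ), p.2 + (k : ℝ)) = u i p)
    (heq : ∀ i p, flatLaplacian (u i) p = ∑ j, c i j p * u j p)
    (hsum : ∀ p, ∑ i, u i p = 0) :
    ∀ i p, u i p = 0 := by
  obtain ⟨M, hM⟩ := exists_sum_abs_eq_const hcoop_off hdom hu_smooth hu_per heq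
  have hsign : ∀ i p (t : ℝ), |t| = 1 → t * u i p = |u i p| →
      ∀ j, t * (c i j p * u j p) = c i j p * |u j p| := by
    intro i p t ht hti j
    obtain ⟨s, hs, hsy, rfl⟩ := exists_sign_eq (fun j => u j p) i ht hti
    have h := (signed_sum_of_sum_abs_eq_const hu_smooth hM hs hsy).2
    simp only [heq] at h
    exact sign_mul_mul_eq_mul_abs (C := fun i j => c i j p)
      (fun i j hij => hcoop_off i j hij p) (hdom · p) hs hsy h i j
  have hpos : ∀ i b, 0 < u i b → ∀ p, 0 < u i p := fun i b hb p =>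
    pos_of_exists_pos (fun i => (hc_smooth i i).continuous) hcoop_off hu_smooth heq hM hsign hb p
  have hnonpos : ∀ i p, u i p ≤ 0 := by
    by_contra! hex
    obtain ⟨i₀, p₀, h₀⟩ := hex
    refine hcoupled ⟨{i | ∃ p, u i p ≤ 0}, {i | ∃ p, u i p ≤ 0}ᶜ, ?_, ⟨i₀, ?_⟩,
      Set.union_compl_self _, disjoint_compl_right, ?_⟩
    · obtain ⟨i, -, hi⟩ := Finset.exists_le_of_sum_le (s := Finset.univ)
        (f := fun i => u i p₀) (g := fun _ => 0) ⟨i₀, Finset.mem_univ _⟩ (by simp [hsum])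
      exact ⟨i, p₀, hi⟩
    · rintro ⟨p, hp⟩
      exact (hpos i₀ p₀ h₀ p).not_ge hp
    · rintro i ⟨q, hq⟩ j hj p
      have hi : u i p ≤ 0 := not_lt.1 fun h => (hpos i p h q).not_ge hq
      have hjp : 0 < u j p := not_le.1 fun h => hj ⟨p, h⟩
      have h := hsign i p (-1) (by simp) (by rw [abs_of_nonpos hi, neg_one_mul]) j
      rw [abs_of_pos hjp] at h
      have h0 : c i j p * u j p = 0 := by linarith
      exact (mul_eq_zero.1 h0).resolve_right hjp.ne'
  intro i p
  exact (Finset.sum_eq_zero_iff_of_nonpos fun j _ => hnonpos j p).1 (hsum p) i (Finset.mem_univ i)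
end

section
/- For f : ℂ → ℂ real-differentiable at z, write ∂f(z) = ½(Df_z(1) − i·Df_z(i)) and ∂̄f(z) = ½(Df_z(1) + i·Df_z(i)) for the Wirtinger derivatives, where Df_z is the real Fréchet derivative of f at z. Let U ⊆ ℂ be open, let w : ℂ → ℂ be twice continuously real-differentiable on U, let λ : ℂ → ℂ be continuously real-differentiable and nowhere vanishing on U, write w̄ = conj ∘ w, and suppose: the function φ₀ := λ · ∂(w̄) is holomorphic (ℂ-differentiable) on U, and the function λ₀ := λ · ∂̄(w̄) is nowhere vanishing on U. Then at every point of U, ∂λ₀ / λ₀ = (∂λ · ∂̄(w̄) − ∂̄λ · ∂(w̄)) / (λ · ∂̄(w̄)). -/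
/-- Wirtinger derivative `∂f = ½(Df(1) − i·Df(i))`, with `Df` the real Fréchet derivative. -/
noncomputable def wirtingerD (f : ℂ → ℂ) (z : ℂ) : ℂ :=
  (1 / 2 : ℂ) * (fderiv ℝ f z 1 - Complex.I * fderiv ℝ f z Complex.I)

/-- Conjugate Wirtinger derivative `∂̄f = ½(Df(1) + i·Df(i))`. -/
noncomputable def wirtingerDBar (f : ℂ → ℂ) (z : ℂ) : ℂ :=
  (1 / 2 : ℂ) * (fderiv ℝ f z 1 + Complex.I * fderiv ℝ f z Complex.I)

theorem wirtingerD_mul {f g : ℂ → ℂ} {z : ℂ} (hf : DifferentiableAt ℝ f z)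
    (hg : DifferentiableAt ℝ g z) :
    wirtingerD (fun x => f x * g x) z = wirtingerD f z * g z + f z * wirtingerD g z := by
  simp only [wirtingerD, fderiv_fun_mul hf hg, add_apply, smul_apply, smul_eq_mul]
  ring

theorem wirtingerDBar_mul {f g : ℂ → ℂ} {z : ℂ} (hf : DifferentiableAt ℝ f z)
    (hg : DifferentiableAt ℝ g z) :
    wirtingerDBar (fun x => f x * g x) z = wirtingerDBar f z * g z + f z * wirtingerDBar g z := by
  simp only [wirtingerDBar, fderiv_fun_mul hf hg, add_apply, smul_apply, smul_eq_mul]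
  ring

theorem wirtingerDBar_eq_zero_of_differentiableAt {f : ℂ → ℂ} {z : ℂ}
    (hf : DifferentiableAt ℂ f z) : wirtingerDBar f z = 0 := by
  have hI : fderiv ℂ f z Complex.I = Complex.I * fderiv ℂ f z 1 := by
    simp
  rw [wirtingerDBar, hf.fderiv_restrictScalars ℝ]
  simp only [ContinuousLinearMap.coe_restrictScalars', hI]
  linear_combination (1 / 2 * fderiv ℂ f z 1) * Complex.I_mul_I

section SecondOrder

variable {f : ℂ → ℂ} {z : ℂ}

theorem ContDiffAt.hasFDerivAt_fderiv_apply (hf : ContDiffAt ℝ 2 f z) (v : ℂ) :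
    HasFDerivAt (fun x => fderiv ℝ f x v) ((fderiv ℝ (fderiv ℝ f) z).flip v) z := by
  have h : DifferentiableAt ℝ (fderiv ℝ f) z :=
    (hf.fderiv_right (m := 1) (by norm_num)).differentiableAt one_ne_zero
  simpa using h.hasFDerivAt.clm_apply (hasFDerivAt_const v z)

theorem ContDiffAt.hasFDerivAt_wirtingerD (hf : ContDiffAt ℝ 2 f z) :
    HasFDerivAt (wirtingerD f) ((1 / 2 : ℂ) • ((fderiv ℝ (fderiv ℝ f) z).flip 1 -
      Complex.I • (fderiv ℝ (fderiv ℝ f) z).flip Complex.I)) z :=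
  ((hf.hasFDerivAt_fderiv_apply 1).sub
    ((hf.hasFDerivAt_fderiv_apply Complex.I).const_mul Complex.I)).const_mul (1 / 2)

theorem ContDiffAt.hasFDerivAt_wirtingerDBar (hf : ContDiffAt ℝ 2 f z) :
    HasFDerivAt (wirtingerDBar f) ((1 / 2 : ℂ) • ((fderiv ℝ (fderiv ℝ f) z).flip 1 +
      Complex.I • (fderiv ℝ (fderiv ℝ f) z).flip Complex.I)) z :=
  ((hf.hasFDerivAt_fderiv_apply 1).add
    ((hf.hasFDerivAt_fderiv_apply Complex.I).const_mul Complex.I)).const_mul (1 / 2)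

theorem ContDiffAt.wirtingerD_wirtingerDBar_comm (hf : ContDiffAt ℝ 2 f z) :
    wirtingerD (wirtingerDBar f) z = wirtingerDBar (wirtingerD f) z := by
  have hsymm : fderiv ℝ (fderiv ℝ f) z 1 Complex.I = fderiv ℝ (fderiv ℝ f) z Complex.I 1 :=
    (hf.isSymmSndFDerivAt (by simp)).eq 1 Complex.I
  rw [wirtingerD, wirtingerDBar, hf.hasFDerivAt_wirtingerD.fderiv,
    hf.hasFDerivAt_wirtingerDBar.fderiv]
  simp only [smul_apply, add_apply, sub_apply, ContinuousLinearMap.flip_apply, smul_eq_mul, hsymm]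
  ring

end SecondOrder

/-- Local-coordinate form of the "log equalities" lemma: if `φ₀ = λ·∂(w̄)` is holomorphic
and `λ₀ = λ·∂̄(w̄)` is nowhere vanishing, then
`∂λ₀ / λ₀ = (∂λ·∂̄(w̄) − ∂̄λ·∂(w̄)) / (λ·∂̄(w̄))` on `U`. -/
theorem stmt10 (U : Set ℂ) (hU : IsOpen U)
    (w lam : ℂ → ℂ)
    (hw : ContDiffOn ℝ 2 w U) (hlam : ContDiffOn ℝ 1 lam U)
    (hlam_ne : ∀ z ∈ U, lam z ≠ 0)
    (wbar : ℂ → ℂ) (hwbar : wbar = fun z => (starRingEnd ℂ) (w z))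
    (phi0 lam0 : ℂ → ℂ)
    (hphi0 : phi0 = fun z => lam z * wirtingerD wbar z)
    (hlam0 : lam0 = fun z => lam z * wirtingerDBar wbar z)
    (hphi0_hol : DifferentiableOn ℂ phi0 U)
    (hlam0_ne : ∀ z ∈ U, lam0 z ≠ 0) :
    ∀ z ∈ U, wirtingerD lam0 z / lam0 z =
      (wirtingerD lam z * wirtingerDBar wbar z - wirtingerDBar lam z * wirtingerD wbar z) /
        (lam z * wirtingerDBar wbar z) := by
  intro z hz
  have hUz := hU.mem_nhds hz
  have hlam' : DifferentiableAt ℝ lam z := (hlam.contDiffAt hUz).differentiableAt one_ne_zero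
  have hwb : ContDiffAt ℝ 2 wbar z := by
    rw [hwbar]
    exact Complex.conjCLE.contDiff.contDiffAt.comp z (hw.contDiffAt hUz)
  have hphi : wirtingerDBar lam z * wirtingerD wbar z +
      lam z * wirtingerDBar (wirtingerD wbar) z = 0 := by
    rw [← wirtingerDBar_mul hlam' hwb.hasFDerivAt_wirtingerD.differentiableAt, ← hphi0]
    exact wirtingerDBar_eq_zero_of_differentiableAt (hphi0_hol.differentiableAt hUz)
  have hderiv : wirtingerD lam0 z = wirtingerD lam z * wirtingerDBar wbar z -
      wirtingerDBar lam z * wirtingerD wbar z := by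
    rw [hlam0, wirtingerD_mul hlam' hwb.hasFDerivAt_wirtingerDBar.differentiableAt,
      hwb.wirtingerD_wirtingerDBar_comm]
    linear_combination hphi
  rw [hderiv, hlam0]
end
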